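/- arXiv:2601.03538 — 3 statements merged into one kernel-verified Lean document; each statement's English description precedes it below -/
import Mathlib

section
/- Let k ≥ 1, let α ∈ ℝᵏ with ‖α‖ < 1, let 0 < η < 1, and let θ ∈ ℝᵏ with ‖θ‖ = η. Then there exists a unique differentiable curve p : (0, η²] → ℝᵏ such that p(η²) = θ and for every t ∈ (0, η²] one has p(t) ≠ 0, ⟨2 • p(t), v_α(p(t))⟩ ≠ 0, and p has derivative (⟨2 • p(t), v_α(p(t))⟩)⁻¹ • v_α(p(t)) at t. Moreover this curve satisfies ‖p(t)‖² = t for all t ∈ (0, η²], and p(t) tends to 0 as t tends to 0 from the right. -/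
open RealInnerProductSpace

/-- The conic vector field `v_α(y) = y + ‖y‖² • α`. -/
noncomputable def conicVF {k : ℕ} (α : EuclideanSpace ℝ (Fin k)) (y : EuclideanSpace ℝ (Fin k)) :
    EuclideanSpace ℝ (Fin k) :=
  y + ‖y‖ ^ 2 • α

section ConicFlow

variable {E : Type*} [NormedAddCommGroup E] [InnerProductSpace ℝ E]

/-- The conformal flow `u' = α - ⟪α, u⟫ • u` on the unit sphere is complete. -/
lemma exists_sphere_flow (α u₀ : E) (hu₀ : ‖u₀‖ = 1) :
    ∃ u : ℝ → E, u 0 = u₀ ∧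
      ∀ s, ‖u s‖ = 1 ∧ HasDerivAt u (α - ⟪α, u s⟫ • u s) s := by
  obtain ⟨e, a, he, rfl⟩ : ∃ (e : E) (a : ℝ), ‖e‖ = 1 ∧ α = a • e := by
    by_cases h : α = 0
    · exact ⟨u₀, 0, hu₀, by simp [h]⟩
    · refine ⟨‖α‖⁻¹ • α, ‖α‖, norm_smul_inv_norm h, ?_⟩
      rw [smul_inv_smul₀ (norm_ne_zero_iff.2 h)]
  set c := ⟪e, u₀⟫ with hc
  have hc1 : |c| ≤ 1 := by simpa [he, hu₀] using abs_real_inner_le_norm e u₀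
  have hcu : ⟪u₀, e⟫ = c := real_inner_comm _ _
  obtain ⟨hc2, hc3⟩ := abs_le.1 hc1
  let D : ℝ → ℝ := fun s => Real.cosh (a * s) + c * Real.sinh (a * s)
  let X : ℝ → ℝ := fun s => Real.sinh (a * s) + c * Real.cosh (a * s)
  let w : ℝ → E := fun s => u₀ + (X s - c) • e
  have hDpos (s : ℝ) : 0 < D s := by
    have h1 := Real.cosh_add_sinh (a * s)
    have h2 := Real.cosh_sub_sinh (a * s)
    have h3 := Real.exp_pos (a * s)
    have h4 := Real.exp_pos (-(a * s))
    have : D s = ((1 + c) * Real.exp (a * s) + (1 - c) * Real.exp (-(a * s))) / 2 := by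
      rw [← h1, ← h2]; simp only [D]; ring
    rw [this]
    rcases lt_or_ge c 0 with h | h
    · have := mul_pos (show 0 < 1 - c by linarith) h4
      have := mul_nonneg (show 0 ≤ 1 + c by linarith) h3.le
      linarith
    · have := mul_nonneg (show 0 ≤ 1 - c by linarith) h4.le
      have := mul_pos (show 0 < 1 + c by linarith) h3
      linarith
  have hmul (s : ℝ) : HasDerivAt (fun s => a * s) a s := by
    simpa using (hasDerivAt_id s).const_mul a
  have hD (s : ℝ) : HasDerivAt D (a * X s) s := by
    refine ((hmul s).cosh.add ((hmul s).sinh.const_mul c)).congr_deriv ?_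
    simp only [X]; ring
  have hX (s : ℝ) : HasDerivAt X (a * D s) s := by
    refine ((hmul s).sinh.add ((hmul s).cosh.const_mul c)).congr_deriv ?_
    simp only [D]; ring
  have hw (s : ℝ) : HasDerivAt w ((a * D s) • e) s :=
    (((hX s).sub_const c).smul_const e).const_add u₀
  have hew (s : ℝ) : ⟪e, w s⟫ = X s := by
    simp only [w, inner_add_right, inner_smul_right, real_inner_self_eq_norm_sq, he, ← hc]
    ring
  have hnw (s : ℝ) : ‖w s‖ = D s := by
    rw [← sq_eq_sq₀ (norm_nonneg _) (hDpos s).le]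
    simp only [w]
    rw [norm_add_sq_real, norm_smul, mul_pow, Real.norm_eq_abs, sq_abs, he, hu₀,
      inner_smul_right, hcu]
    simp only [X, D]
    linear_combination (c ^ 2 - 1) * Real.cosh_sq (a * s)
  refine ⟨fun s => (D s)⁻¹ • w s, by simp [D, X, w], fun s => ⟨?_, ?_⟩⟩
  · rw [norm_smul, hnw, norm_inv, Real.norm_of_nonneg (hDpos s).le,
      inv_mul_cancel₀ (hDpos s).ne']
  · refine (((hD s).inv (hDpos s).ne').smul (hw s)).congr_deriv ?_
    have := (hDpos s).ne'
    simp only [inner_smul_right, inner_smul_left, hew, smul_smul, Pi.inv_apply]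
    rw [sub_eq_add_neg, ← neg_smul]
    congr 2
    · field_simp
    · simp; field_simp

/-- A time change `σ' = 1 / (1 + r c(σ))` on `[0, η]` with prescribed value at `η`. -/
lemma exists_time_change {c : ℝ → ℝ} (hc : ∀ s, |c s| ≤ 1) (hcL : LipschitzWith 1 c)
    {η : ℝ} (hη0 : 0 < η) (hη1 : η < 1) :
    ∃ σ : ℝ → ℝ, σ η = 0 ∧ ∀ r ∈ Set.Icc 0 η,
      HasDerivWithinAt σ (1 + r * c (σ r))⁻¹ (Set.Icc 0 η) r := by
  have hm : 0 < 1 - η := by linarith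
  have hlow : ∀ r ∈ Set.Icc 0 η, ∀ s, 1 - η ≤ 1 + r * c s := by
    intro r hr s
    nlinarith [(abs_le.1 (hc s)).1, hr.1, hr.2]
  obtain ⟨M, hM⟩ : ∃ M : NNReal, (M : ℝ) = (1 - η)⁻¹ :=
    ⟨_, Real.coe_toNNReal _ (inv_pos.2 hm).le⟩
  refine IsPicardLindelof.exists_eq_forall_mem_Icc_hasDerivWithinAt₀
    (f := fun r s => (1 + r * c s)⁻¹) (t₀ := ⟨η, hη0.le, le_rfl⟩) (a := M) (L := M)
    (K := M * M) ⟨?_, ?_, ?_, ?_⟩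
  · intro r hr
    refine LipschitzOnWith.of_dist_le_mul fun x _ y _ => ?_
    have hx := hlow r hr x
    have hy := hlow r hr y
    have h := hcL.dist_le_mul x y
    simp only [NNReal.coe_one, one_mul, Real.dist_eq] at h ⊢
    rw [inv_sub_inv (by linarith) (by linarith), abs_div, abs_mul,
      abs_of_pos (show 0 < 1 + r * c x by linarith), abs_of_pos (show 0 < 1 + r * c y by linarith),
      show 1 + r * c y - (1 + r * c x) = -(r * (c x - c y)) by ring, abs_neg, abs_mul,
      abs_of_nonneg hr.1]
    have h1 : r * |c x - c y| ≤ |x - y| := by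
      nlinarith [hr.1, hr.2, abs_nonneg (c x - c y)]
    calc r * |c x - c y| / ((1 + r * c x) * (1 + r * c y))
        ≤ |x - y| / ((1 - η) * (1 - η)) := by
          have : 0 ≤ 1 + r * c x := by linarith
          gcongr
      _ = ↑(M * M) * |x - y| := by
        rw [NNReal.coe_mul, hM]; field_simp
  · intro x _
    refine ContinuousOn.inv₀ (by fun_prop) fun r hr => ?_
    have := hlow r hr x
    linarith
  · intro r hr x _
    have := hlow r hr x
    rw [Real.norm_of_nonneg (inv_nonneg.2 (by linarith))]
    exact hM ▸ inv_anti₀ hm this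
  · have h : 0 ≤ (M : ℝ) := M.2
    simp only [sub_self, sub_zero, NNReal.coe_zero, max_eq_right hη0.le]
    nlinarith

/-- On the sphere `‖y‖² = t` the normalized conic field equals
`(2t(1 + ⟪y, α⟫))⁻¹ • (y + t • α)`; the latter is Lipschitz in `y` on balls of radius below 1. -/
lemma lipschitzOnWith_radial_conic {α : E} (hα : ‖α‖ < 1) {η : ℝ} (hη0 : 0 < η) (hη1 : η < 1)
    {b : ℝ} (hb : 0 < b) : ∃ K : NNReal, ∀ t ∈ Set.Icc b (η ^ 2),
      LipschitzOnWith K (fun y : E => (2 * t * (1 + ⟪y, α⟫))⁻¹ • (y + t • α))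
        (Metric.closedBall 0 η) := by
  have hm : 0 < 1 - η := by linarith
  have hlow : ∀ y ∈ Metric.closedBall (0 : E) η, 1 - η ≤ 1 + ⟪y, α⟫ := by
    intro y hy
    have h1 := abs_le.1 (abs_real_inner_le_norm y α)
    have h2 : ‖y‖ ≤ η := by simpa using hy
    nlinarith [norm_nonneg y, norm_nonneg α, h1.1]
  obtain ⟨K, hK⟩ : ∃ K : NNReal,
      (K : ℝ) = (2 * b)⁻¹ * ((1 - η)⁻¹ + 2 * ((1 - η) * (1 - η))⁻¹) :=
    ⟨_, Real.coe_toNNReal _ (by positivity)⟩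
  refine ⟨K, fun t ht => LipschitzOnWith.of_dist_le_mul fun y hy z hz => ?_⟩
  have ht0 : 0 < t := hb.trans_le ht.1
  have hA := hlow y hy
  have hB := hlow z hz
  have hinner : |⟪z, α⟫ - ⟪y, α⟫| ≤ ‖y - z‖ := by
    rw [← inner_sub_left, norm_sub_rev]
    exact (abs_real_inner_le_norm _ _).trans (mul_le_of_le_one_right (norm_nonneg _) hα.le)
  have hzt : ‖z + t • α‖ ≤ 2 := by
    have hz' : ‖z‖ ≤ η := by simpa using hz
    have : ‖t • α‖ ≤ 1 := by
      rw [norm_smul, Real.norm_of_nonneg ht0.le]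
      exact mul_le_one₀ (ht.2.trans (by nlinarith)) (norm_nonneg _) hα.le
    linarith [norm_add_le z (t • α)]
  set A := 1 + ⟪y, α⟫ with hAd
  set B := 1 + ⟪z, α⟫ with hBd
  have hA0 : 0 < A := by linarith
  have hB0 : 0 < B := by linarith
  have hdiff : (2 * t * A)⁻¹ • (y + t • α) - (2 * t * B)⁻¹ • (z + t • α)
      = (2 * t)⁻¹ • (A⁻¹ • (y - z) + ((B - A) * (A * B)⁻¹) • (z + t • α)) := by
    match_scalars <;> field_simp
    ring
  have hBA : B - A = ⟪z, α⟫ - ⟪y, α⟫ := by rw [hAd, hBd]; ring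
  rw [dist_eq_norm, dist_eq_norm, hdiff, norm_smul, hK, mul_assoc,
    Real.norm_of_nonneg (by positivity)]
  have htb := ht.1
  refine mul_le_mul (by gcongr) ?_ (norm_nonneg _) (by positivity)
  refine (norm_add_le _ _).trans ?_
  rw [norm_smul, norm_smul, add_mul (1 - η)⁻¹, norm_mul,
    Real.norm_of_nonneg (show 0 ≤ A⁻¹ by positivity),
    Real.norm_of_nonneg (show 0 ≤ (A * B)⁻¹ by positivity), hBA, Real.norm_eq_abs]
  refine add_le_add (by gcongr) ?_
  calc |⟪z, α⟫ - ⟪y, α⟫| * (A * B)⁻¹ * ‖z + t • α‖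
      ≤ ‖y - z‖ * ((1 - η) * (1 - η))⁻¹ * 2 := by gcongr
    _ = _ := by ring

end ConicFlow

section ConicCurve

variable {k : ℕ} {α : EuclideanSpace ℝ (Fin k)}

lemma inner_two_smul_conicVF (y : EuclideanSpace ℝ (Fin k)) :
    ⟪(2 : ℝ) • y, conicVF α y⟫ = 2 * ‖y‖ ^ 2 * (1 + ⟪y, α⟫) := by
  rw [conicVF, inner_smul_left, inner_add_right, inner_smul_right, real_inner_self_eq_norm_sq]
  simp only [RCLike.conj_to_real]
  ring

/-- Along an integral curve of the normalized conic field, `‖·‖²` has unit speed. -/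
lemma norm_sq_eq_of_integral_curve {T : ℝ} {q : ℝ → EuclideanSpace ℝ (Fin k)}
    (hT : ‖q T‖ ^ 2 = T)
    (hq : ∀ t ∈ Set.Ioc 0 T, ⟪(2 : ℝ) • q t, conicVF α (q t)⟫ ≠ 0 ∧
      HasDerivWithinAt q ((⟪(2 : ℝ) • q t, conicVF α (q t)⟫)⁻¹ • conicVF α (q t))
        (Set.Ioc 0 T) t) :
    ∀ t ∈ Set.Ioc 0 T, ‖q t‖ ^ 2 = t := by
  intro t ht
  have hd : ∀ s ∈ Set.Ioc 0 T,
      HasDerivWithinAt (fun s => ‖q s‖ ^ 2 - s) 0 (Set.Ioc 0 T) s := by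
    intro s hs
    obtain ⟨h0, h1⟩ := hq s hs
    refine (h1.norm_sq.sub (hasDerivWithinAt_id s _)).congr_deriv ?_
    rw [inner_smul_right, sub_eq_zero]
    rw [inner_smul_left] at h0 ⊢
    simp only [RCLike.conj_to_real] at h0 ⊢
    have := right_ne_zero_of_mul h0
    field_simp
  have hTm : T ∈ Set.Ioc 0 T := ⟨ht.1.trans_le ht.2, le_rfl⟩
  have := (convex_Ioc (0 : ℝ) T).norm_image_sub_le_of_norm_hasDerivWithin_le (C := 0) hd
    (fun s _ => by simp) hTm ht
  simp only [zero_mul, norm_le_zero_iff, hT, sub_self, sub_zero] at this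
  linarith

end ConicCurve

/-- existence and uniqueness of the integral curve of the normalized conic
vector field v̂_α on (0, η²] with p(η²) = θ; moreover ‖p t‖² = t and p(t) → 0 as t → 0⁺. -/
theorem integral_curve_exists_unique (k : ℕ) (hk : 1 ≤ k) (α : EuclideanSpace ℝ (Fin k))
    (hα : ‖α‖ < 1) (η : ℝ) (hη0 : 0 < η) (hη1 : η < 1)
    (θ : EuclideanSpace ℝ (Fin k)) (hθ : ‖θ‖ = η) :
    ∃ p : ℝ → EuclideanSpace ℝ (Fin k),
      (p (η ^ 2) = θ ∧
        ∀ t ∈ Set.Ioc 0 (η ^ 2), p t ≠ 0 ∧ ⟪(2 : ℝ) • p t, conicVF α (p t)⟫ ≠ 0 ∧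
          HasDerivWithinAt p ((⟪(2 : ℝ) • p t, conicVF α (p t)⟫)⁻¹ • conicVF α (p t))
            (Set.Ioc 0 (η ^ 2)) t) ∧
      (∀ q : ℝ → EuclideanSpace ℝ (Fin k),
        (q (η ^ 2) = θ ∧
          ∀ t ∈ Set.Ioc 0 (η ^ 2), q t ≠ 0 ∧ ⟪(2 : ℝ) • q t, conicVF α (q t)⟫ ≠ 0 ∧
            HasDerivWithinAt q ((⟪(2 : ℝ) • q t, conicVF α (q t)⟫)⁻¹ • conicVF α (q t))
              (Set.Ioc 0 (η ^ 2)) t) →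
        ∀ t ∈ Set.Ioc 0 (η ^ 2), q t = p t) ∧
      (∀ t ∈ Set.Ioc 0 (η ^ 2), ‖p t‖ ^ 2 = t) ∧
      Filter.Tendsto p (nhdsWithin 0 (Set.Ioi 0)) (nhds 0) := by
  have hα' := hα.le
  have hu₀ : ‖η⁻¹ • θ‖ = 1 := by
    rw [norm_smul, hθ, norm_inv, Real.norm_of_nonneg hη0.le, inv_mul_cancel₀ hη0.ne']
  obtain ⟨u, hu0, hu⟩ := exists_sphere_flow α _ hu₀
  let c : ℝ → ℝ := fun s => ⟪α, u s⟫
  have hcα (s : ℝ) : |c s| ≤ ‖α‖ := by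
    simpa [(hu s).1] using abs_real_inner_le_norm α (u s)
  have hcd (s : ℝ) : HasDerivAt c (‖α‖ ^ 2 - c s ^ 2) s := by
    have := (hasDerivAt_const s α).inner ℝ (hu s).2
    refine this.congr_deriv ?_
    rw [inner_sub_right, inner_smul_right, real_inner_self_eq_norm_sq, inner_zero_left]
    simp only [c]
    ring
  have hcL : LipschitzWith 1 c := by
    refine lipschitzWith_of_nnnorm_deriv_le (fun s => (hcd s).differentiableAt) fun s => ?_
    rw [(hcd s).deriv, ← NNReal.coe_le_coe, coe_nnnorm, Real.norm_eq_abs, NNReal.coe_one, abs_le]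
    have := sq_le_sq' (abs_le.1 (hcα s)).1 (abs_le.1 (hcα s)).2
    constructor <;> nlinarith [norm_nonneg α, sq_nonneg (c s)]
  obtain ⟨σ, hση, hσ⟩ :=
    exists_time_change (fun s => (hcα s).trans hα') hcL hη0 hη1
  let p : ℝ → EuclideanSpace ℝ (Fin k) := fun t => √t • u (σ √t)
  have hpn (t : ℝ) : ‖p t‖ = √t := by
    simp only [p]
    rw [norm_smul, (hu _).1, mul_one, Real.norm_of_nonneg (Real.sqrt_nonneg t)]
  have hpη : p (η ^ 2) = θ := by
    simp only [p]
    rw [Real.sqrt_sq hη0.le, hση, hu0, smul_inv_smul₀ hη0.ne']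
  have hsqrt : Set.MapsTo Real.sqrt (Set.Ioc 0 (η ^ 2)) (Set.Icc 0 η) := fun t ht =>
    ⟨Real.sqrt_nonneg t, Real.sqrt_le_iff.2 ⟨hη0.le, ht.2⟩⟩
  have hpder : ∀ t ∈ Set.Ioc 0 (η ^ 2), p t ≠ 0 ∧ ⟪(2 : ℝ) • p t, conicVF α (p t)⟫ ≠ 0 ∧
      HasDerivWithinAt p ((⟪(2 : ℝ) • p t, conicVF α (p t)⟫)⁻¹ • conicVF α (p t))
        (Set.Ioc 0 (η ^ 2)) t := by
    intro t ht
    have hr : 0 < √t := Real.sqrt_pos.2 ht.1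
    have hrt : √t ^ 2 = t := Real.sq_sqrt ht.1.le
    have hden : 0 < 1 + √t * c (σ √t) := by
      have h1 := (abs_le.1 (hcα (σ √t))).1
      have h2 := (hsqrt ht).2
      nlinarith
    have hin : ⟪p t, α⟫ = √t * c (σ √t) := by
      simp only [p, c]
      rw [inner_smul_left, real_inner_comm]
      simp
    rw [inner_two_smul_conicVF, hpn, hrt, hin]
    refine ⟨fun h => hr.ne' (by rw [← hpn t, h, norm_zero]),
      mul_ne_zero (mul_ne_zero two_ne_zero ht.1.ne') hden.ne', ?_⟩
    have hs := (Real.hasDerivAt_sqrt ht.1.ne').hasDerivWithinAt (s := Set.Ioc 0 (η ^ 2))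
    have hσs := (hσ _ (hsqrt ht)).comp t hs hsqrt
    refine (hs.smul ((hu _).2.scomp_hasDerivWithinAt t hσs)).congr_deriv ?_
    rw [conicVF, hpn, hrt]
    change _ + (1 / (2 * √t)) • u (σ √t) = _
    simp only [p, Function.comp_apply]
    change √t • ((1 + √t * c (σ √t))⁻¹ * (1 / (2 * √t))) • (α - c (σ √t) • u (σ √t)) + _ = _
    generalize c (σ √t) = C at hden
    generalize √t = r at *
    subst hrt
    match_scalars <;> field_simp
    ring
  have hpsq := norm_sq_eq_of_integral_curve (by rw [hpη, hθ]) fun t ht => (hpder t ht).2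
  refine ⟨p, ⟨hpη, hpder⟩, ?_, hpsq, ?_⟩
  · rintro q ⟨hqη, hq⟩ b hb
    have hqsq := norm_sq_eq_of_integral_curve (by rw [hqη, hθ]) fun t ht => (hq t ht).2
    obtain ⟨K, hK⟩ := lipschitzOnWith_radial_conic hα hη0 hη1 hb.1
    have hsub : Set.Icc b (η ^ 2) ⊆ Set.Ioc 0 (η ^ 2) := fun t ht => ⟨hb.1.trans_le ht.1, ht.2⟩
    have key : ∀ f : ℝ → EuclideanSpace ℝ (Fin k),
        (∀ t ∈ Set.Ioc 0 (η ^ 2), f t ≠ 0 ∧ ⟪(2 : ℝ) • f t, conicVF α (f t)⟫ ≠ 0 ∧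
          HasDerivWithinAt f ((⟪(2 : ℝ) • f t, conicVF α (f t)⟫)⁻¹ • conicVF α (f t))
            (Set.Ioc 0 (η ^ 2)) t) → (∀ t ∈ Set.Ioc 0 (η ^ 2), ‖f t‖ ^ 2 = t) →
        ContinuousOn f (Set.Icc b (η ^ 2)) ∧
        (∀ t ∈ Set.Ioc b (η ^ 2), HasDerivWithinAt f
          ((2 * t * (1 + ⟪f t, α⟫))⁻¹ • (f t + t • α)) (Set.Iic t) t) ∧
        ∀ t ∈ Set.Ioc b (η ^ 2), f t ∈ Metric.closedBall 0 η := by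
      intro f hf hfn
      refine ⟨fun t ht => (hf t (hsub ht)).2.2.continuousWithinAt.mono hsub,
        fun t ht => ?_, fun t ht => ?_⟩
      · have ht' := hsub (Set.Ioc_subset_Icc_self ht)
        have h := (hf t ht').2.2
        rw [inner_two_smul_conicVF, conicVF, hfn t ht'] at h
        refine h.mono_of_mem_nhdsWithin ?_
        filter_upwards [self_mem_nhdsWithin, mem_nhdsWithin_of_mem_nhds (Ioi_mem_nhds ht'.1)]
          with x hx hx0
        exact ⟨hx0, le_trans hx ht'.2⟩
      · have ht' := hsub (Set.Ioc_subset_Icc_self ht)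
        rw [mem_closedBall_zero_iff]
        exact le_of_sq_le_sq ((hfn t ht').trans_le ht'.2) hη0.le
    obtain ⟨hqc, hqd, hqs⟩ := key q hq hqsq
    obtain ⟨hpc, hpd, hps⟩ := key p hpder hpsq
    exact ODE_solution_unique_of_mem_Icc_left
      (v := fun t y => (2 * t * (1 + ⟪y, α⟫))⁻¹ • (y + t • α))
      (fun t ht => hK t (Set.Ioc_subset_Icc_self ht)) hqc hqd hqs hpc hpd hps
      (hqη.trans hpη.symm) ⟨le_rfl, hb.2⟩
  · rw [tendsto_zero_iff_norm_tendsto_zero]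
    simp only [hpn]
    have := Real.continuous_sqrt.tendsto 0
    rw [Real.sqrt_zero] at this
    exact this.mono_left nhdsWithin_le_nhds
end

section
/- Let k ≥ 1, let α ∈ ℝᵏ with ‖α‖ < 1, and let 0 < η < 1. Then there exists a bijection h from the closed ball B = {y ∈ ℝᵏ : ‖y‖ ≤ η} onto itself such that: (i) h and its inverse are continuous (h is a homeomorphism of B) and h(0) = 0; (ii) h and h⁻¹ are C^∞ on B \ {0}; (iii) ‖h(y)‖ = √(η ‖y‖) for every y ∈ B; and (iv) for every θ with ‖θ‖ = η, the curve t ↦ h(t • θ) on (0, 1] is differentiable with derivative at t equal to η² • (⟨2 • h(t • θ), v_α(h(t • θ))⟩)⁻¹ • v_α(h(t • θ)), i.e. h maps each radial segment {t • θ : 0 < t ≤ 1} onto an integral curve of the normalized conic vector field v̂_α. In particular h is a conic homeomorphism associated to v_α. -/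
open RealInnerProductSpace

open Filter Topology

/-- The entire function with `cosSqrt (x ^ 2) = cos x`. -/
noncomputable def cosSqrt : ℝ → ℝ :=
  FormalMultilinearSeries.ofScalarsSum fun n : ℕ => (-1 : ℝ) ^ n / (2 * n).factorial

/-- The entire function with `x * sincSqrt (x ^ 2) = sin x`. -/
noncomputable def sincSqrt : ℝ → ℝ :=
  FormalMultilinearSeries.ofScalarsSum fun n : ℕ => (-1 : ℝ) ^ n / (2 * n + 1).factorial

theorem contDiff_ofScalarsSum_of_tendsto {c : ℕ → ℝ} (hc : ∀ n, c n ≠ 0)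
    (hc' : Tendsto (fun n => ‖c n.succ‖ / ‖c n‖) atTop (𝓝 0)) :
    ContDiff ℝ (⊤ : ℕ∞) (FormalMultilinearSeries.ofScalarsSum c : ℝ → ℝ) := by
  have hr := FormalMultilinearSeries.ofScalars_radius_eq_top_of_tendsto ℝ c
    (Eventually.of_forall hc) hc'
  have h := (FormalMultilinearSeries.ofScalars ℝ c).hasFPowerSeriesOnBall (by simp [hr])
  rw [hr] at h
  rw [contDiff_iff_contDiffAt]
  exact fun x => (h.analyticAt_of_mem (by simp)).contDiffAt

theorem contDiff_cosSqrt : ContDiff ℝ (⊤ : ℕ∞) cosSqrt := by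
  refine contDiff_ofScalarsSum_of_tendsto (fun n => by positivity) ?_
  refine squeeze_zero (fun n => by positivity) (fun n => ?_)
    (tendsto_one_div_add_atTop_nhds_zero_nat (𝕜 := ℝ))
  have h : ((2 * n.succ).factorial : ℝ) = (2 * n + 2) * ((2 * n + 1) * (2 * n).factorial) := by
    rw [show 2 * n.succ = 2 * n + 1 + 1 by rfl, Nat.factorial_succ, Nat.factorial_succ]
    push_cast
    ring
  have hf : (0 : ℝ) < (2 * n).factorial := by positivity
  simp only [norm_div, norm_pow, norm_neg, norm_one, one_pow, h, norm_mul, Real.norm_natCast]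
  rw [Real.norm_of_nonneg (by positivity), Real.norm_of_nonneg (by positivity)]
  rw [div_div_eq_mul_div, div_mul_eq_mul_div, div_div,
    div_le_div_iff₀ (by positivity) (by positivity)]
  have hn : (0 : ℝ) ≤ n := by positivity
  have : (n : ℝ) + 1 ≤ (2 * n + 2) * (2 * n + 1) := by nlinarith
  nlinarith

theorem contDiff_sincSqrt : ContDiff ℝ (⊤ : ℕ∞) sincSqrt := by
  refine contDiff_ofScalarsSum_of_tendsto (fun n => by positivity) ?_
  refine squeeze_zero (fun n => by positivity) (fun n => ?_)
    (tendsto_one_div_add_atTop_nhds_zero_nat (𝕜 := ℝ))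
  have h : ((2 * n.succ + 1).factorial : ℝ) =
      (2 * n + 3) * ((2 * n + 2) * (2 * n + 1).factorial) := by
    rw [show 2 * n.succ + 1 = 2 * n + 1 + 1 + 1 by rfl, Nat.factorial_succ, Nat.factorial_succ]
    push_cast
    ring
  have hf : (0 : ℝ) < (2 * n + 1).factorial := by positivity
  simp only [norm_div, norm_pow, norm_neg, norm_one, one_pow, h, norm_mul, Real.norm_natCast]
  rw [Real.norm_of_nonneg (by positivity), Real.norm_of_nonneg (by positivity)]
  rw [div_div_eq_mul_div, div_mul_eq_mul_div, div_div,
    div_le_div_iff₀ (by positivity) (by positivity)]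
  have hn : (0 : ℝ) ≤ n := by positivity
  have : (n : ℝ) + 1 ≤ (2 * n + 3) * (2 * n + 2) := by nlinarith
  nlinarith

theorem cosSqrt_sq (x : ℝ) : cosSqrt (x ^ 2) = Real.cos x := by
  rw [cosSqrt, FormalMultilinearSeries.ofScalars_sum_eq, ← (Real.hasSum_cos x).tsum_eq]
  refine tsum_congr fun n => ?_
  rw [smul_eq_mul, ← pow_mul]
  ring

theorem mul_sincSqrt_sq (x : ℝ) : x * sincSqrt (x ^ 2) = Real.sin x := by
  rw [sincSqrt, FormalMultilinearSeries.ofScalars_sum_eq, ← (Real.hasSum_sin x).tsum_eq,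
    ← tsum_mul_left]
  refine tsum_congr fun n => ?_
  rw [smul_eq_mul, ← pow_mul]
  ring

theorem sincSqrt_zero : sincSqrt 0 = 1 := by
  simp [sincSqrt]

theorem cosSqrt_zero : cosSqrt 0 = 1 := by
  simp [cosSqrt]

theorem cosSqrt_sq_add_mul_sincSqrt_sq {w : ℝ} (hw : 0 ≤ w) :
    cosSqrt w ^ 2 + w * sincSqrt w ^ 2 = 1 := by
  have h := Real.sin_sq_add_cos_sq √w
  rw [← cosSqrt_sq, ← mul_sincSqrt_sq, Real.sq_sqrt hw, mul_pow, Real.sq_sqrt hw] at h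
  linarith

theorem sincSqrt_sq_le_one {w : ℝ} (hw : 0 ≤ w) : sincSqrt w ^ 2 ≤ 1 := by
  rcases hw.eq_or_lt with rfl | hw'
  · simp [sincSqrt_zero]
  have h := Real.sin_sq_le_sq (x := √w)
  rw [← mul_sincSqrt_sq, mul_pow, Real.sq_sqrt hw] at h
  nlinarith

theorem hasDerivAt_mul_sincSqrt {q : ℝ} (hq : 0 ≤ q) (t : ℝ) :
    HasDerivAt (fun s => s * sincSqrt (s ^ 2 * q)) (cosSqrt (t ^ 2 * q)) t := by
  obtain ⟨c, rfl⟩ : ∃ c, q = c ^ 2 := ⟨√q, (Real.sq_sqrt hq).symm⟩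
  rcases eq_or_ne c 0 with rfl | hc
  · simpa [sincSqrt_zero, cosSqrt_zero] using hasDerivAt_id' t
  have h : HasDerivAt (fun s => Real.sin (s * c) / c) (Real.cos (t * c) * (1 * c) / c) t :=
    (((hasDerivAt_id t).mul_const c).sin).div_const c
  rw [one_mul, mul_div_cancel_right₀ _ hc, ← cosSqrt_sq, mul_pow] at h
  refine h.congr_of_eventuallyEq (Eventually.of_forall fun s => ?_)
  simp only [← mul_sincSqrt_sq, mul_pow]
  field_simp

theorem hasDerivAt_cosSqrt {q : ℝ} (hq : 0 ≤ q) (t : ℝ) :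
    HasDerivAt (fun s => cosSqrt (s ^ 2 * q)) (-(q * (t * sincSqrt (t ^ 2 * q)))) t := by
  obtain ⟨c, rfl⟩ : ∃ c, q = c ^ 2 := ⟨√q, (Real.sq_sqrt hq).symm⟩
  have h := ((hasDerivAt_id t).mul_const c).cos
  simp only [id, ← mul_sincSqrt_sq, ← cosSqrt_sq, mul_pow] at h
  convert h using 1
  ring

section

variable {E : Type*} [NormedAddCommGroup E] [InnerProductSpace ℝ E]

/-- The Gram determinant of `α` and `y`. -/
noncomputable def gramDet (α y : E) : ℝ := ‖α‖ ^ 2 * ‖y‖ ^ 2 - ⟪α, y⟫ ^ 2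

/-- The map `y ↦ R y` where `R` rotates the plane spanned by `α` and `y` by the angle
`√(gramDet α y)`, away from `α`; it is constant, up to scaling, on orbits of `v_α`. -/
noncomputable def unwind (α y : E) : E :=
  (cosSqrt (gramDet α y) + ⟪α, y⟫ * sincSqrt (gramDet α y)) • y -
    (‖y‖ ^ 2 * sincSqrt (gramDet α y)) • α

/-- The function whose zero `τ` determines the preimage of `z` under `unwind α`. -/
noncomputable def scaleEqn (α z : E) (τ : ℝ) : ℝ :=
  τ - cosSqrt (τ ^ 2 * gramDet α z) + ⟪α, z⟫ * (τ * sincSqrt (τ ^ 2 * gramDet α z))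

/-- The zero of `scaleEqn α z`. -/
noncomputable def conicScale (α z : E) : ℝ := Classical.epsilon fun τ => scaleEqn α z τ = 0

/-- The inverse of `unwind α` on the unit ball. -/
noncomputable def wind (α z : E) : E :=
  conicScale α z • z +
    (conicScale α z * ‖z‖ ^ 2 * sincSqrt (conicScale α z ^ 2 * gramDet α z)) • α

theorem gramDet_nonneg (α y : E) : 0 ≤ gramDet α y := by
  have h := abs_real_inner_le_norm α y
  have := sq_le_sq' (by linarith [neg_abs_le ⟪α, y⟫, norm_nonneg α]) ((le_abs_self _).trans h)
  rw [gramDet]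
  linarith [mul_pow ‖α‖ ‖y‖ 2]

theorem hasDerivAt_scaleEqn (α z : E) (τ : ℝ) :
    HasDerivAt (scaleEqn α z)
      (1 + gramDet α z * (τ * sincSqrt (τ ^ 2 * gramDet α z)) +
        ⟪α, z⟫ * cosSqrt (τ ^ 2 * gramDet α z)) τ := by
  have h := ((hasDerivAt_id τ).sub (hasDerivAt_cosSqrt (gramDet_nonneg α z) τ)).add
    ((hasDerivAt_mul_sincSqrt (gramDet_nonneg α z) τ).const_mul ⟪α, z⟫)
  exact h.congr_deriv (by ring)

theorem one_sub_le_deriv_scaleEqn (α z : E) (τ : ℝ) :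
    1 - ‖α‖ * ‖z‖ ≤ 1 + gramDet α z * (τ * sincSqrt (τ ^ 2 * gramDet α z)) +
        ⟪α, z⟫ * cosSqrt (τ ^ 2 * gramDet α z) := by
  have hq := gramDet_nonneg α z
  have h := cosSqrt_sq_add_mul_sincSqrt_sq (mul_nonneg (sq_nonneg τ) hq)
  have hg : gramDet α z + ⟪α, z⟫ ^ 2 = (‖α‖ * ‖z‖) ^ 2 := by rw [gramDet]; ring
  set q := gramDet α z
  set S := sincSqrt (τ ^ 2 * q)
  set K := cosSqrt (τ ^ 2 * q)
  set X := ⟪α, z⟫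
  have key : (q * (τ * S) + X * K) ^ 2 ≤ (‖α‖ * ‖z‖) ^ 2 := by
    have : (q + X ^ 2) * (K ^ 2 + τ ^ 2 * q * S ^ 2) - (q * (τ * S) + X * K) ^ 2
        = q * (K - X * τ * S) ^ 2 := by ring
    rw [← hg]
    nlinarith [mul_nonneg hq (sq_nonneg (K - X * τ * S))]
  have := abs_le_of_sq_le_sq' key (by positivity)
  linarith [this.1]

theorem strictMono_scaleEqn {α z : E} (h : ‖α‖ * ‖z‖ < 1) : StrictMono (scaleEqn α z) :=
  strictMono_of_deriv_pos fun τ => by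
    rw [(hasDerivAt_scaleEqn α z τ).deriv]
    linarith [one_sub_le_deriv_scaleEqn α z τ]

theorem scaleEqn_zero (α z : E) : scaleEqn α z 0 = -1 := by
  simp [scaleEqn, cosSqrt_zero]

theorem scaleEqn_conicScale {α z : E} (h : ‖α‖ * ‖z‖ < 1) :
    scaleEqn α z (conicScale α z) = 0 := by
  refine Classical.epsilon_spec (p := fun τ => scaleEqn α z τ = 0) ?_
  have hd : 0 < 1 - ‖α‖ * ‖z‖ := by linarith
  have hdiff : Differentiable ℝ (scaleEqn α z) :=
    fun τ => (hasDerivAt_scaleEqn α z τ).differentiableAt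
  have hT : (0 : ℝ) ≤ (1 - ‖α‖ * ‖z‖)⁻¹ := by positivity
  have hbig := mul_sub_le_image_sub_of_le_deriv hdiff (C := 1 - ‖α‖ * ‖z‖)
    (fun τ => by
      rw [(hasDerivAt_scaleEqn α z τ).deriv]
      exact one_sub_le_deriv_scaleEqn α z τ) hT
  rw [sub_zero, mul_inv_cancel₀ hd.ne', scaleEqn_zero] at hbig
  obtain ⟨τ, -, hτ⟩ := intermediate_value_Icc hT hdiff.continuous.continuousOn
    (show (0 : ℝ) ∈ Set.Icc _ _ from ⟨by rw [scaleEqn_zero]; norm_num, by linarith⟩)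
  exact ⟨τ, hτ⟩

theorem conicScale_eq {α z : E} (h : ‖α‖ * ‖z‖ < 1) {τ : ℝ} (hτ : scaleEqn α z τ = 0) :
    conicScale α z = τ :=
  (strictMono_scaleEqn h).injective ((scaleEqn_conicScale h).trans hτ.symm)

theorem conicScale_pos {α z : E} (h : ‖α‖ * ‖z‖ < 1) : 0 < conicScale α z := by
  rw [← (strictMono_scaleEqn h).lt_iff_lt, scaleEqn_conicScale h, scaleEqn_zero]
  norm_num

theorem norm_smul_add_smul_sq (a b : ℝ) (α z : E) :
    ‖a • z + b • α‖ ^ 2 = a ^ 2 * ‖z‖ ^ 2 + 2 * a * b * ⟪α, z⟫ + b ^ 2 * ‖α‖ ^ 2 := by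
  rw [norm_add_sq_real, norm_smul, norm_smul, real_inner_smul_left, real_inner_smul_right,
    real_inner_comm, mul_pow, mul_pow, Real.norm_eq_abs, Real.norm_eq_abs, sq_abs, sq_abs]
  ring

theorem inner_smul_add_smul (a b : ℝ) (α z : E) :
    ⟪α, a • z + b • α⟫ = a * ⟪α, z⟫ + b * ‖α‖ ^ 2 := by
  rw [inner_add_right, real_inner_smul_right, real_inner_smul_right, real_inner_self_eq_norm_sq]

theorem gramDet_smul_add_smul (a b : ℝ) (α z : E) :
    gramDet α (a • z + b • α) = a ^ 2 * gramDet α z := by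
  rw [gramDet, norm_smul_add_smul_sq, inner_smul_add_smul, gramDet]
  ring

theorem gramDet_smul (a : ℝ) (α z : E) : gramDet α (a • z) = a ^ 2 * gramDet α z := by
  simpa using gramDet_smul_add_smul a 0 α z

theorem unwind_eq (α y : E) : unwind α y =
    (cosSqrt (gramDet α y) + ⟪α, y⟫ * sincSqrt (gramDet α y)) • y +
      (-(‖y‖ ^ 2 * sincSqrt (gramDet α y))) • α := by
  rw [unwind, neg_smul, sub_eq_add_neg]

theorem norm_unwind (α y : E) : ‖unwind α y‖ = ‖y‖ := by
  rw [← sq_eq_sq₀ (norm_nonneg _) (norm_nonneg _), unwind_eq, norm_smul_add_smul_sq]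
  have h := cosSqrt_sq_add_mul_sincSqrt_sq (gramDet_nonneg α y)
  have hq : ‖α‖ ^ 2 * ‖y‖ ^ 2 = gramDet α y + ⟪α, y⟫ ^ 2 := by rw [gramDet]; ring
  linear_combination ‖y‖ ^ 2 * h + ‖y‖ ^ 2 * sincSqrt (gramDet α y) ^ 2 * hq

theorem norm_wind {α z : E} (hz : ‖α‖ * ‖z‖ < 1) : ‖wind α z‖ = ‖z‖ := by
  rw [← sq_eq_sq₀ (norm_nonneg _) (norm_nonneg _), wind, norm_smul_add_smul_sq]
  have hτ := scaleEqn_conicScale hz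
  rw [scaleEqn] at hτ
  have h := cosSqrt_sq_add_mul_sincSqrt_sq
    (mul_nonneg (sq_nonneg (conicScale α z)) (gramDet_nonneg α z))
  have hq : ‖α‖ ^ 2 * ‖z‖ ^ 2 = gramDet α z + ⟪α, z⟫ ^ 2 := by rw [gramDet]; ring
  set τ := conicScale α z
  set S := sincSqrt (τ ^ 2 * gramDet α z)
  set K := cosSqrt (τ ^ 2 * gramDet α z)
  linear_combination ‖z‖ ^ 2 * h + ‖z‖ ^ 2 * (τ + ⟪α, z⟫ * τ * S + K) * hτ +
    ‖z‖ ^ 2 * τ ^ 2 * S ^ 2 * hq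

theorem unwind_wind {α z : E} (hz : ‖α‖ * ‖z‖ < 1) : unwind α (wind α z) = z := by
  have hτ := scaleEqn_conicScale hz
  rw [scaleEqn] at hτ
  have h := cosSqrt_sq_add_mul_sincSqrt_sq
    (mul_nonneg (sq_nonneg (conicScale α z)) (gramDet_nonneg α z))
  have hq : ‖α‖ ^ 2 * ‖z‖ ^ 2 = gramDet α z + ⟪α, z⟫ ^ 2 := by rw [gramDet]; ring
  rw [unwind, norm_wind hz, wind, gramDet_smul_add_smul, inner_smul_add_smul]
  set τ := conicScale α z
  set S := sincSqrt (τ ^ 2 * gramDet α z)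
  set K := cosSqrt (τ ^ 2 * gramDet α z)
  have hD : (K + (τ * ⟪α, z⟫ + τ * ‖z‖ ^ 2 * S * ‖α‖ ^ 2) * S) * τ = 1 := by
    linear_combination h + (⟪α, z⟫ * τ * S + K) * hτ + τ ^ 2 * S ^ 2 * hq
  rw [smul_add, smul_smul, smul_smul, hD, one_smul, add_sub_assoc, ← sub_smul]
  rw [show (K + (τ * ⟪α, z⟫ + τ * ‖z‖ ^ 2 * S * ‖α‖ ^ 2) * S) * (τ * ‖z‖ ^ 2 * S) -
    ‖z‖ ^ 2 * S = 0 by linear_combination ‖z‖ ^ 2 * S * hD]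
  simp

theorem wind_unwind {α y : E} (hy : ‖α‖ * ‖y‖ < 1) : wind α (unwind α y) = y := by
  have h := cosSqrt_sq_add_mul_sincSqrt_sq (gramDet_nonneg α y)
  have hS := sincSqrt_sq_le_one (gramDet_nonneg α y)
  have hq : ‖α‖ ^ 2 * ‖y‖ ^ 2 = gramDet α y + ⟪α, y⟫ ^ 2 := by rw [gramDet]; ring
  have hz : ‖α‖ * ‖unwind α y‖ < 1 := by rwa [norm_unwind]
  have hn := norm_unwind α y
  have hg := gramDet_smul_add_smul (cosSqrt (gramDet α y) + ⟪α, y⟫ * sincSqrt (gramDet α y))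
    (-(‖y‖ ^ 2 * sincSqrt (gramDet α y))) α y
  have hi := inner_smul_add_smul (cosSqrt (gramDet α y) + ⟪α, y⟫ * sincSqrt (gramDet α y))
    (-(‖y‖ ^ 2 * sincSqrt (gramDet α y))) α y
  rw [← unwind_eq] at hg hi
  have hE := unwind_eq α y
  set z := unwind α y
  set S := sincSqrt (gramDet α y)
  set K := cosSqrt (gramDet α y)
  set X := ⟪α, y⟫
  have hD : K + X * S ≠ 0 := by
    intro hD
    have h1 : ‖α‖ ^ 2 * ‖y‖ ^ 2 < 1 := by
      rw [← mul_pow]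
      exact pow_lt_one₀ (by positivity) hy two_ne_zero
    have h2 : (‖α‖ ^ 2 * ‖y‖ ^ 2) * S ^ 2 = 1 := by
      linear_combination h + S ^ 2 * hq - (K - X * S) * hD
    nlinarith [sq_nonneg S, sq_nonneg (‖α‖ * ‖y‖)]
  have hgD : ((K + X * S)⁻¹) ^ 2 * gramDet α z = gramDet α y := by
    rw [hg]
    field_simp
  have hτ : conicScale α z = (K + X * S)⁻¹ := by
    refine conicScale_eq hz ?_
    rw [scaleEqn, hgD, hi]
    change (K + X * S)⁻¹ - K + ((K + X * S) * X + -(‖y‖ ^ 2 * S) * ‖α‖ ^ 2) *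
      ((K + X * S)⁻¹ * S) = 0
    field_simp
    linear_combination -h - S ^ 2 * hq
  rw [wind, hτ, hgD, hn]
  change (K + X * S)⁻¹ • z + ((K + X * S)⁻¹ * ‖y‖ ^ 2 * S) • α = y
  rw [hE, smul_add, smul_smul, smul_smul, inv_mul_cancel₀ hD, one_smul, add_assoc, ← add_smul]
  simp [mul_assoc]

theorem contDiff_gramDet (α : E) : ContDiff ℝ (⊤ : ℕ∞) (gramDet α) := by
  have h1 : ContDiff ℝ (⊤ : ℕ∞) fun y : E => ‖y‖ ^ 2 := contDiff_norm_sq ℝ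
  have h2 : ContDiff ℝ (⊤ : ℕ∞) fun y : E => ⟪α, y⟫ := contDiff_const.inner ℝ contDiff_id
  exact (contDiff_const.mul h1).sub (h2.pow 2)

theorem contDiff_unwind (α : E) : ContDiff ℝ (⊤ : ℕ∞) (unwind α) := by
  have h1 : ContDiff ℝ (⊤ : ℕ∞) fun y : E => ‖y‖ ^ 2 := contDiff_norm_sq ℝ
  have h2 : ContDiff ℝ (⊤ : ℕ∞) fun y : E => ⟪α, y⟫ := contDiff_const.inner ℝ contDiff_id
  have hK := contDiff_cosSqrt.comp (contDiff_gramDet α)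
  have hS := contDiff_sincSqrt.comp (contDiff_gramDet α)
  exact ((hK.add (h2.mul hS)).smul contDiff_id).sub ((h1.mul hS).smul contDiff_const)

theorem contDiff_scaleEqn (α : E) :
    ContDiff ℝ (⊤ : ℕ∞) fun p : E × ℝ => scaleEqn α p.1 p.2 := by
  have h2 : ContDiff ℝ (⊤ : ℕ∞) fun p : E × ℝ => ⟪α, p.1⟫ := contDiff_const.inner ℝ contDiff_fst
  have hg : ContDiff ℝ (⊤ : ℕ∞) fun p : E × ℝ => p.2 ^ 2 * gramDet α p.1 :=
    (contDiff_snd.pow 2).mul ((contDiff_gramDet α).comp contDiff_fst)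
  exact (contDiff_snd.sub (contDiff_cosSqrt.comp hg)).add
    (h2.mul (contDiff_snd.mul (contDiff_sincSqrt.comp hg)))

theorem contDiffAt_conicScale [CompleteSpace E] {α z : E} (hz : ‖α‖ * ‖z‖ < 1) :
    ContDiffAt ℝ (⊤ : ℕ∞) (conicScale α) z := by
  set u : E × ℝ := (z, conicScale α z)
  have hF : ContDiffAt ℝ (⊤ : ℕ∞) (fun p : E × ℝ => scaleEqn α p.1 p.2) u :=
    (contDiff_scaleEqn α).contDiffAt
  have hn : ((⊤ : ℕ∞) : WithTop ℕ∞) ≠ 0 := by simp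
  set L := fderiv ℝ (fun p : E × ℝ => scaleEqn α p.1 p.2) u ∘L .inr ℝ E ℝ
  have hL : L 1 ≠ 0 := by
    have h1 : HasDerivAt (fun τ : ℝ => ((z, τ) : E × ℝ)) (0, 1) (conicScale α z) :=
      (hasDerivAt_const _ _).prodMk (hasDerivAt_id _)
    have h2 := (hF.differentiableAt hn).hasFDerivAt.comp_hasDerivAt _ h1
    have h3 := h2.unique (hasDerivAt_scaleEqn α z (conicScale α z))
    have h4 := one_sub_le_deriv_scaleEqn α z (conicScale α z)
    rw [← h3] at h4
    refine (lt_of_lt_of_le ?_ h4).ne'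
    linarith
  have hinv : L.IsInvertible := ⟨ContinuousLinearEquiv.unitsEquivAut ℝ (Units.mk0 _ hL), by
    ext
    simp⟩
  refine (hF.contDiffAt_implicitFunction hn hinv).congr_of_eventuallyEq ?_
  have hopen : ∀ᶠ x in 𝓝 z, ‖α‖ * ‖x‖ < 1 :=
    (continuous_const.mul continuous_norm).continuousAt.eventually_lt continuousAt_const hz
  filter_upwards [hF.eventually_apply_implicitFunction hn hinv, hopen] with x hx hx1
  exact conicScale_eq hx1 (hx.trans (scaleEqn_conicScale hz))

theorem contDiffAt_wind [CompleteSpace E] {α z : E} (hz : ‖α‖ * ‖z‖ < 1) :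
    ContDiffAt ℝ (⊤ : ℕ∞) (wind α) z := by
  have hτ := contDiffAt_conicScale hz
  have h1 : ContDiffAt ℝ (⊤ : ℕ∞) (fun y : E => ‖y‖ ^ 2) z := (contDiff_norm_sq ℝ).contDiffAt
  have hS := contDiff_sincSqrt.contDiffAt.comp z
    ((hτ.pow 2).mul (contDiff_gramDet α).contDiffAt)
  exact (hτ.smul contDiffAt_id).add (((hτ.mul h1).mul hS).smul contDiffAt_const)

/-- Along each ray, `wind α` has derivative parallel to the field `y ↦ y + ‖y‖ ^ 2 • α`. -/
theorem hasDerivAt_wind_smul [CompleteSpace E] {α θ : E} {σ : ℝ} (hσ : 0 < σ)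
    (h : ‖α‖ * ‖σ • θ‖ < 1) :
    ∃ c : ℝ, HasDerivAt (fun s : ℝ => wind α (s • θ))
      (c • (wind α (σ • θ) + ‖wind α (σ • θ)‖ ^ 2 • α)) σ := by
  set q := gramDet α θ with hq_def
  have hq : 0 ≤ q := gramDet_nonneg α θ
  set l : ℝ → ℝ := fun s => s * conicScale α (s • θ) with hl_def
  have hl_pos : 0 < l σ := mul_pos hσ (conicScale_pos h)
  obtain ⟨l', hl'⟩ : ∃ l', HasDerivAt l l' σ := by
    have h1 : HasDerivAt (fun s : ℝ => s • θ) ((1 : ℝ) • θ) σ := (hasDerivAt_id σ).smul_const θ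
    have h2 := ((contDiffAt_conicScale h).differentiableAt
      (by simp)).hasFDerivAt.comp_hasDerivAt _ h1
    exact ⟨_, (hasDerivAt_id σ).mul h2⟩
  set A : ℝ → ℝ := fun s => l s * sincSqrt (l s ^ 2 * q) with hA_def
  set K : ℝ → ℝ := fun s => cosSqrt (l s ^ 2 * q) with hK_def
  have hA : HasDerivAt A (K σ * l') σ := (hasDerivAt_mul_sincSqrt hq (l σ)).comp σ hl'
  have hK : HasDerivAt K (-(q * A σ) * l') σ := (hasDerivAt_cosSqrt hq (l σ)).comp σ hl'
  have hscale : ∀ s : ℝ, conicScale α (s • θ) ^ 2 * gramDet α (s • θ) = l s ^ 2 * q := by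
    intro s
    rw [gramDet_smul]
    ring
  have hrel : ∀ s : ℝ, ‖α‖ * ‖s • θ‖ < 1 → l s = s * (K s - ⟪α, θ⟫ * A s) := by
    intro s hs
    have hτ := scaleEqn_conicScale hs
    rw [scaleEqn, hscale, real_inner_smul_right] at hτ
    simp only [hA_def, hK_def]
    linear_combination s * hτ
  have hwind : ∀ s : ℝ, wind α (s • θ) = l s • θ + (s * A s * ‖θ‖ ^ 2) • α := by
    intro s
    rw [wind, hscale, smul_smul, norm_smul, mul_pow, Real.norm_eq_abs, sq_abs]
    simp only [hA_def, hl_def]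
    congr 2 <;> ring
  have hopen : ∀ᶠ s in 𝓝 σ, ‖α‖ * ‖s • θ‖ < 1 :=
    ContinuousAt.eventually_lt (f := fun s : ℝ => ‖α‖ * ‖s • θ‖) (by fun_prop)
      continuousAt_const h
  have hl'eq : l' = (K σ - ⟪α, θ⟫ * A σ) +
      σ * (-(q * A σ) * l' - ⟪α, θ⟫ * (K σ * l')) := by
    have h1 := ((hasDerivAt_id σ).mul (hK.sub (hA.const_mul ⟪α, θ⟫))).congr_of_eventuallyEq
      (hopen.mono hrel)
    have h2 := hl'.unique h1
    simpa using h2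
  have hder : HasDerivAt (fun s : ℝ => wind α (s • θ))
      (l' • θ + ((A σ + σ * (K σ * l')) * ‖θ‖ ^ 2) • α) σ := by
    have h1 := (hl'.smul_const θ).add
      ((((hasDerivAt_id σ).mul hA).mul_const (‖θ‖ ^ 2)).smul_const α)
    rw [funext hwind]
    refine h1.congr_deriv ?_
    simp
  refine ⟨l' / l σ, ?_⟩
  convert hder using 1
  have hKA : K σ ^ 2 + q * A σ ^ 2 = 1 := by
    have := cosSqrt_sq_add_mul_sincSqrt_sq (mul_nonneg (sq_nonneg (l σ)) hq)
    simp only [hA_def, hK_def]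
    linear_combination this
  rw [norm_wind h, hwind, norm_smul, mul_pow, Real.norm_eq_abs, sq_abs, add_assoc, ← add_smul,
    smul_add, smul_smul, smul_smul, div_mul_cancel₀ _ hl_pos.ne']
  congr 2
  rw [div_mul_eq_mul_div, div_eq_iff hl_pos.ne']
  have hr := hrel σ h
  generalize l σ = L at *
  generalize A σ = a at *
  generalize K σ = κ at *
  generalize ⟪α, θ⟫ = X at *
  subst hr
  linear_combination σ * a * ‖θ‖ ^ 2 * hl'eq - σ ^ 2 * ‖θ‖ ^ 2 * l' * hKA

end

/-- the conic homeomorphism of the closed ball of radius η associated to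
the conic vector field v_α: a homeomorphism of the ball fixing the origin, smooth away
from the origin together with its inverse, with ‖h(y)‖ = √(η‖y‖), mapping each radial
segment onto an integral curve of the normalized conic vector field v̂_α. -/
theorem conic_homeomorphism_exists (k : ℕ) (hk : 1 ≤ k) (α : EuclideanSpace ℝ (Fin k))
    (hα : ‖α‖ < 1) (η : ℝ) (hη0 : 0 < η) (hη1 : η < 1) :
    ∃ h g : EuclideanSpace ℝ (Fin k) → EuclideanSpace ℝ (Fin k),
      (Set.MapsTo h (Metric.closedBall 0 η) (Metric.closedBall 0 η) ∧
       Set.MapsTo g (Metric.closedBall 0 η) (Metric.closedBall 0 η) ∧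
       (∀ y ∈ Metric.closedBall (0 : EuclideanSpace ℝ (Fin k)) η, g (h y) = y) ∧
       (∀ y ∈ Metric.closedBall (0 : EuclideanSpace ℝ (Fin k)) η, h (g y) = y) ∧
       ContinuousOn h (Metric.closedBall 0 η) ∧
       ContinuousOn g (Metric.closedBall 0 η) ∧
       h 0 = 0) ∧
      (ContDiffOn ℝ (⊤ : ℕ∞) h (Metric.closedBall 0 η \ {0}) ∧
       ContDiffOn ℝ (⊤ : ℕ∞) g (Metric.closedBall 0 η \ {0})) ∧
      (∀ y ∈ Metric.closedBall (0 : EuclideanSpace ℝ (Fin k)) η,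
        ‖h y‖ = Real.sqrt (η * ‖y‖)) ∧
      (∀ θ : EuclideanSpace ℝ (Fin k), ‖θ‖ = η → ∀ t ∈ Set.Ioc (0 : ℝ) 1,
        HasDerivWithinAt (fun s : ℝ => h (s • θ))
          (η ^ 2 • ((⟪(2 : ℝ) • h (t • θ), conicVF α (h (t • θ))⟫)⁻¹ •
            conicVF α (h (t • θ))))
          (Set.Ioc 0 1) t) := by
  have hsmall : ∀ r : ℝ, 0 ≤ r → r ≤ η → ‖α‖ * r < 1 := fun r h0 h1 => by
    nlinarith [norm_nonneg α]
  have hnorm : ∀ z : EuclideanSpace ℝ (Fin k), ‖√(η / ‖z‖) • z‖ = √(η * ‖z‖) := fun z => by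
    rw [norm_smul, Real.norm_of_nonneg (Real.sqrt_nonneg _)]
    rcases (norm_nonneg z).eq_or_lt with h0 | h0
    · simp [← h0]
    rw [← Real.sqrt_sq h0.le, ← Real.sqrt_mul (by positivity), Real.sqrt_sq h0.le]
    congr 1
    field_simp
  have hle : ∀ r : ℝ, 0 ≤ r → r ≤ η → √(η * r) ≤ η := fun r h0 h1 =>
    Real.sqrt_le_iff.2 ⟨hη0.le, by nlinarith⟩
  have hdom : ∀ z ∈ Metric.closedBall (0 : EuclideanSpace ℝ (Fin k)) η,
      ‖α‖ * ‖√(η / ‖z‖) • z‖ < 1 := fun z hz => by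
    rw [mem_closedBall_zero_iff] at hz
    rw [hnorm]
    exact hsmall _ (Real.sqrt_nonneg _) (hle _ (norm_nonneg z) hz)
  set h : EuclideanSpace ℝ (Fin k) → EuclideanSpace ℝ (Fin k) :=
    fun z => wind α (√(η / ‖z‖) • z) with h_def
  set g : EuclideanSpace ℝ (Fin k) → EuclideanSpace ℝ (Fin k) :=
    fun y => (‖y‖ / η) • unwind α y with g_def
  have hh : ∀ z ∈ Metric.closedBall (0 : EuclideanSpace ℝ (Fin k)) η, ‖h z‖ = √(η * ‖z‖) :=
    fun z hz => by rw [h_def, norm_wind (hdom z hz), hnorm]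
  have hg : ∀ y, ‖g y‖ = ‖y‖ ^ 2 / η := fun y => by
    rw [g_def, norm_smul, norm_unwind, Real.norm_of_nonneg (by positivity)]
    ring
  have hh0 : h 0 = 0 := by simp [h_def, wind]
  have hg0 : g 0 = 0 := by simp [g_def]
  have hsmooth : ∀ z ∈ Metric.closedBall (0 : EuclideanSpace ℝ (Fin k)) η \ {0},
      ContDiffAt ℝ (⊤ : ℕ∞) h z := fun z ⟨hz, hz0⟩ => by
    have hz0' : z ≠ 0 := hz0
    have hpos : 0 < ‖z‖ := norm_pos_iff.2 hz0'
    have h1 : ContDiffAt ℝ (⊤ : ℕ∞) (fun y : EuclideanSpace ℝ (Fin k) => √(η / ‖y‖) • y) z :=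
      ((contDiffAt_const.div (contDiffAt_norm ℝ hz0') hpos.ne').sqrt
        (div_pos hη0 hpos).ne').smul contDiffAt_id
    exact ContDiffAt.comp (f := fun y : EuclideanSpace ℝ (Fin k) => √(η / ‖y‖) • y) z
      (contDiffAt_wind (hdom z hz)) h1
  refine ⟨h, g, ⟨?_, ?_, ?_, ?_, ?_, ?_, hh0⟩, ⟨?_, ?_⟩, hh, ?_⟩
  · intro z hz
    rw [mem_closedBall_zero_iff, hh z hz]
    exact hle _ (norm_nonneg z) (mem_closedBall_zero_iff.1 hz)
  · intro y hy
    rw [mem_closedBall_zero_iff] at hy ⊢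
    rw [hg, div_le_iff₀ hη0]
    nlinarith [norm_nonneg y]
  · intro z hz
    rcases eq_or_ne z 0 with rfl | hz0
    · rw [hh0, hg0]
    have hpos : 0 < ‖z‖ := norm_pos_iff.2 hz0
    change (‖h z‖ / η) • unwind α (wind α (√(η / ‖z‖) • z)) = z
    rw [unwind_wind (hdom z hz), hh z hz, smul_smul, div_mul_eq_mul_div,
      ← Real.sqrt_mul (by positivity), show η * ‖z‖ * (η / ‖z‖) = η ^ 2 by field_simp,
      Real.sqrt_sq hη0.le, div_self hη0.ne', one_smul]
  · intro y hy
    rcases eq_or_ne y 0 with rfl | hy0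
    · rw [hg0, hh0]
    have hpos : 0 < ‖y‖ := norm_pos_iff.2 hy0
    change wind α (√(η / ‖g y‖) • (‖y‖ / η) • unwind α y) = y
    rw [hg, show η / (‖y‖ ^ 2 / η) = (η / ‖y‖) ^ 2 by field_simp, Real.sqrt_sq (by positivity),
      smul_smul, show η / ‖y‖ * (‖y‖ / η) = 1 by field_simp, one_smul,
      wind_unwind (hsmall _ (norm_nonneg y) (mem_closedBall_zero_iff.1 hy))]
  · intro z hz
    rcases eq_or_ne z 0 with rfl | hz0
    · rw [ContinuousWithinAt, hh0, tendsto_zero_iff_norm_tendsto_zero]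
      have h1 : Tendsto (fun z : EuclideanSpace ℝ (Fin k) => √(η * ‖z‖))
          (𝓝[Metric.closedBall 0 η] 0) (𝓝 0) := by
        have : Continuous fun z : EuclideanSpace ℝ (Fin k) => √(η * ‖z‖) := by fun_prop
        simpa using (this.tendsto 0).mono_left nhdsWithin_le_nhds
      exact h1.congr' (eventually_nhdsWithin_of_forall fun z hz => (hh z hz).symm)
    · exact (hsmooth z ⟨hz, hz0⟩).continuousAt.continuousWithinAt
  · exact ((continuous_norm.div_const η).smul (contDiff_unwind α).continuous).continuousOn
  · exact fun z hz => (hsmooth z hz).contDiffWithinAt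
  · exact fun y hy => (((contDiffAt_norm ℝ hy.2).div_const η).smul
      (contDiff_unwind α).contDiffAt).contDiffWithinAt
  · intro θ hθ t ht
    have hball : ∀ s ∈ Set.Ioc (0 : ℝ) 1,
        s • θ ∈ Metric.closedBall (0 : EuclideanSpace ℝ (Fin k)) η := fun s hs => by
      rw [mem_closedBall_zero_iff, norm_smul, hθ, Real.norm_of_nonneg hs.1.le]
      nlinarith [hs.2]
    have hray : ∀ s ∈ Set.Ioc (0 : ℝ) 1, h (s • θ) = wind α (√s • θ) := fun s hs => by
      have hs0 := hs.1
      change wind α (√(η / ‖s • θ‖) • s • θ) = _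
      rw [norm_smul, hθ, Real.norm_of_nonneg hs0.le, smul_smul]
      congr 2
      rw [show η / (s * η) = s⁻¹ by field_simp, Real.sqrt_inv, inv_mul_eq_div, Real.div_sqrt]
    have hsq : ∀ s ∈ Set.Ioc (0 : ℝ) 1, ‖h (s • θ)‖ ^ 2 = η ^ 2 * s := fun s hs => by
      have hs0 := hs.1
      rw [hh _ (hball s hs), Real.sq_sqrt (by positivity), norm_smul, hθ,
        Real.norm_of_nonneg hs0.le]
      ring
    have hdomt : ‖α‖ * ‖√t • θ‖ < 1 := by
      rw [norm_smul, hθ, Real.norm_of_nonneg (Real.sqrt_nonneg t)]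
      have := Real.sqrt_le_one.2 ht.2
      exact hsmall _ (by positivity) (by nlinarith)
    obtain ⟨c, hc⟩ := hasDerivAt_wind_smul (Real.sqrt_pos.2 ht.1) hdomt
    rw [← hray t ht] at hc
    have hder : HasDerivWithinAt (fun s : ℝ => h (s • θ))
        ((1 / (2 * √t) * c) • conicVF α (h (t • θ))) (Set.Ioc 0 1) t := by
      have h1 := (hc.scomp t (Real.hasDerivAt_sqrt ht.1.ne')).hasDerivWithinAt (s := Set.Ioc 0 1)
      rw [smul_smul] at h1
      exact h1.congr hray (hray t ht)
    have huniq : UniqueDiffWithinAt ℝ (Set.Ioc (0 : ℝ) 1) t := uniqueDiffOn_Ioc 0 1 t ht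
    have hsc := huniq.eq_deriv _ hder.norm_sq
      ((((hasDerivAt_id t).const_mul (η ^ 2)).hasDerivWithinAt).congr hsq (hsq t ht))
    rw [real_inner_smul_right, mul_one] at hsc
    rw [smul_smul, real_inner_smul_left]
    convert hder using 2
    have hne : 2 * ⟪h (t • θ), conicVF α (h (t • θ))⟫ ≠ 0 := by
      intro h0
      have : η ^ 2 = 0 := by rw [← hsc]; linear_combination (1 / (2 * √t) * c) * h0
      exact (pow_pos hη0 2).ne' this
    rw [← div_eq_mul_inv, div_eq_iff hne, ← hsc]
    ring
end

section
/- Let f : ℝ³ → ℝ² be the polynomial map f(x, y, z) = (x²z + y³ − z, x). Then the total derivative fderiv ℝ f (x, y, z) : ℝ³ → ℝ² fails to be surjective if and only if y = 0 and x² = 1; that is, the critical set of f is {(x, 0, z) : x = 1 or x = −1}. In particular, f is a submersion at every point of the open unit ball of ℝ³. -/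
/-- The map f(x,y,z) = (x²z + y³ − z, x) of Example 2.5. -/
noncomputable def exampleMap : EuclideanSpace ℝ (Fin 3) → EuclideanSpace ℝ (Fin 2) :=
  fun p => (WithLp.equiv 2 (Fin 2 → ℝ)).symm ![p 0 ^ 2 * p 2 + p 1 ^ 3 - p 2, p 0]

theorem exampleMap_differentiable : Differentiable ℝ exampleMap := by
  rw [differentiable_euclidean]
  intro i
  fin_cases i <;> simp [exampleMap] <;> fun_prop

theorem fderiv_exampleMap_apply_zero (p v : EuclideanSpace ℝ (Fin 3)) :
    fderiv ℝ exampleMap p v 0 =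
      2 * p 0 * p 2 * v 0 + 3 * p 1 ^ 2 * v 1 + (p 0 ^ 2 - 1) * v 2 := by
  have h := (EuclideanSpace.proj 0 : EuclideanSpace ℝ (Fin 2) →L[ℝ] ℝ).hasFDerivAt.comp p
    (exampleMap_differentiable p).hasFDerivAt
  have hc (i : Fin 3) : HasFDerivAt (fun q : EuclideanSpace ℝ (Fin 3) => q i)
      (EuclideanSpace.proj i : EuclideanSpace ℝ (Fin 3) →L[ℝ] ℝ) p :=
    (EuclideanSpace.proj i : EuclideanSpace ℝ (Fin 3) →L[ℝ] ℝ).hasFDerivAt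
  have h' := ((((hc 0).pow 2).mul (hc 2)).add ((hc 1).pow 3)).sub (hc 2)
  have := congrArg (fun L => L v) (h.unique h')
  simp at this
  rw [this]
  ring

theorem fderiv_exampleMap_apply_one (p v : EuclideanSpace ℝ (Fin 3)) :
    fderiv ℝ exampleMap p v 1 = v 0 := by
  have h := (EuclideanSpace.proj 1 : EuclideanSpace ℝ (Fin 2) →L[ℝ] ℝ).hasFDerivAt.comp p
    (exampleMap_differentiable p).hasFDerivAt
  exact congrArg (fun L => L v) (h.unique
    (EuclideanSpace.proj 0 : EuclideanSpace ℝ (Fin 3) →L[ℝ] ℝ).hasFDerivAt)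

theorem surjective_fderiv_exampleMap_iff (p : EuclideanSpace ℝ (Fin 3)) :
    Function.Surjective (fderiv ℝ exampleMap p) ↔ ¬ (p 1 = 0 ∧ p 0 ^ 2 = 1) := by
  constructor
  · rintro h ⟨h1, h0⟩
    obtain ⟨v, hv⟩ := h !₂[1, 0]
    have e0 := fderiv_exampleMap_apply_zero p v
    have e1 := fderiv_exampleMap_apply_one p v
    rw [hv] at e0 e1
    simp [h1, h0, ← e1] at e0
  · intro h w
    by_cases h1 : p 1 = 0
    · have h0 : p 0 ^ 2 - 1 ≠ 0 := fun h0 => h ⟨h1, by linarith⟩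
      refine ⟨!₂[w 1, 0, (w 0 - 2 * p 0 * p 2 * w 1) / (p 0 ^ 2 - 1)], ?_⟩
      ext i
      fin_cases i
      · simp [fderiv_exampleMap_apply_zero, mul_div_cancel₀ _ h0]
      · simp [fderiv_exampleMap_apply_one]
    · refine ⟨!₂[w 1, (w 0 - 2 * p 0 * p 2 * w 1) / (3 * p 1 ^ 2), 0], ?_⟩
      ext i
      fin_cases i
      · simp [fderiv_exampleMap_apply_zero]
        field_simp
        ring
      · simp [fderiv_exampleMap_apply_one]

/-- the derivative of f(x,y,z) = (x²z + y³ − z, x) fails to be surjective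
exactly when y = 0 and x² = 1; in particular f is a submersion on the open unit ball. -/
theorem exampleMap_critical_set :
    (∀ p : EuclideanSpace ℝ (Fin 3),
      ¬ Function.Surjective (fderiv ℝ exampleMap p) ↔ p 1 = 0 ∧ p 0 ^ 2 = 1) ∧
    (∀ p : EuclideanSpace ℝ (Fin 3), ‖p‖ < 1 →
      Function.Surjective (fderiv ℝ exampleMap p)) := by
  refine ⟨fun p => by rw [surjective_fderiv_exampleMap_iff, not_not], fun p hp => ?_⟩
  rw [surjective_fderiv_exampleMap_iff]
  rintro ⟨-, h0⟩
  have h : ‖p 0‖ ≤ ‖p‖ := PiLp.norm_apply_le p 0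
  have : p 0 ^ 2 < 1 := (sq_lt_one_iff_abs_lt_one _).2 (h.trans_lt hp)
  exact this.ne h0
end
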